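/- Let f ∈ ℚ[X] be a polynomial of degree at least 1, let A = ℚ[t₁^{±1}, t₂^{±1}] be the Laurent polynomial ring in two variables over ℚ, and set t₃ := t₁⁻¹·t₂⁻¹ ∈ A. If p, q ∈ A satisfy p·(f(t₃) − f(t₁)) = q·(f(t₂) − f(t₁)), then f(t₂) − f(t₁) divides p in A. -/

import Mathlib

noncomputable section

/-- `A = ℚ[t₁^{±1}, t₂^{±1}]`, the Laurent polynomial ring in two variables over ℚ,
realized as the group algebra of `ℤ × ℤ` over `ℚ`. -/
abbrev LaurentTwo : Type := AddMonoidAlgebra ℚ (ℤ × ℤ)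

/-- The variable `t₁`. -/
def t₁ : LaurentTwo := AddMonoidAlgebra.of' ℚ (ℤ × ℤ) (1, 0)

/-- The variable `t₂`. -/
def t₂ : LaurentTwo := AddMonoidAlgebra.of' ℚ (ℤ × ℤ) (0, 1)

/-- `t₃ = t₁⁻¹·t₂⁻¹`. -/
def t₃ : LaurentTwo := AddMonoidAlgebra.of' ℚ (ℤ × ℤ) (-1, -1)

open MvPolynomial in
/-- The substitution `Xᵢ ↦ Xᵢ T`, recording the total-degree grading in the variable `T`. -/
def homogenizingHom (σ : Type*) :
    MvPolynomial σ ℚ →ₐ[ℚ] Polynomial (MvPolynomial σ ℚ) :=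
  aeval fun i => Polynomial.C (X i) * Polynomial.X

lemma eval_one_homogenizingHom {σ : Type*} (d : MvPolynomial σ ℚ) :
    (homogenizingHom σ d).eval 1 = d := by
  induction d using MvPolynomial.induction_on with
  | C a => simp [homogenizingHom, MvPolynomial.algebraMap_eq]
  | add p q hp hq => simp [hp, hq]
  | mul_X p i hp => simp [hp]; simp [homogenizingHom]

lemma map_constantCoeff_homogenizingHom {σ : Type*} (d : MvPolynomial σ ℚ) :
    (homogenizingHom σ d).map MvPolynomial.constantCoeff =
      Polynomial.C (MvPolynomial.constantCoeff d) := by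
  induction d using MvPolynomial.induction_on with
  | C a => simp [homogenizingHom, MvPolynomial.algebraMap_eq]
  | add p q hp hq => simp [hp, hq]
  | mul_X p i hp => simp [hp]; simp [homogenizingHom]

lemma isUnit_of_isUnit_leadingCoeff_homogenizingHom {σ : Type*} {d : MvPolynomial σ ℚ}
    (h : IsUnit (homogenizingHom σ d).leadingCoeff) : IsUnit d := by
  have hdeg : (homogenizingHom σ d).natDegree = 0 := by
    by_contra hne
    have hc := congrArg (fun r => r.coeff (homogenizingHom σ d).natDegree)
      (map_constantCoeff_homogenizingHom d)
    simp only [Polynomial.coeff_map, Polynomial.coeff_C, if_neg hne] at hc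
    exact (h.map MvPolynomial.constantCoeff).ne_zero hc
  have hd := eval_one_homogenizingHom d
  rw [Polynomial.eq_C_of_natDegree_eq_zero hdeg, Polynomial.eval_C] at hd
  rwa [Polynomial.leadingCoeff, hdeg, hd] at h

/-- Polynomials whose top-degree forms are relatively prime are relatively prime. -/
lemma isRelPrime_of_leadingCoeff_homogenizingHom {σ : Type*} {p q : MvPolynomial σ ℚ}
    (h : IsRelPrime (homogenizingHom σ p).leadingCoeff (homogenizingHom σ q).leadingCoeff) :
    IsRelPrime p q := by
  have key : ∀ {a b : MvPolynomial σ ℚ}, a ∣ b →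
      (homogenizingHom σ a).leadingCoeff ∣ (homogenizingHom σ b).leadingCoeff := by
    rintro a _ ⟨c, rfl⟩
    rw [map_mul, Polynomial.leadingCoeff_mul]
    exact dvd_mul_right _ _
  exact fun d hp hq => isUnit_of_isUnit_leadingCoeff_homogenizingHom (h (key hp) (key hq))

lemma MvPolynomial.isRelPrime_X_pow_sub_X_pow {n : ℕ} (hn : n ≠ 0) :
    IsRelPrime (X 1 ^ n - X 0 ^ n : MvPolynomial (Fin 2) ℚ)
      ((X 0 * X 1) ^ n * X 0 ^ n) := by
  have h01 : ¬ (X 0 : MvPolynomial (Fin 2) ℚ) ∣ X 1 := by simp [X_dvd_X]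
  have h10 : ¬ (X 1 : MvPolynomial (Fin 2) ℚ) ∣ X 0 := by simp [X_dvd_X]
  have h0 : IsRelPrime (X 1 ^ n - X 0 ^ n : MvPolynomial (Fin 2) ℚ) (X 0) := by
    refine ((X_prime.irreducible.isRelPrime_iff_not_dvd).2 fun h => h01 ?_).symm
    exact X_prime.dvd_of_dvd_pow ((dvd_sub_left (dvd_pow_self _ hn)).1 h)
  have h1 : IsRelPrime (X 1 ^ n - X 0 ^ n : MvPolynomial (Fin 2) ℚ) (X 1) := by
    refine ((X_prime.irreducible.isRelPrime_iff_not_dvd).2 fun h => h10 ?_).symm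
    exact X_prime.dvd_of_dvd_pow ((dvd_sub_right (dvd_pow_self _ hn)).1 h)
  exact ((h0.mul_right h1).pow_right).mul_right h0.pow_right

/-- The first relation, `f(t₂) - f(t₁)`, as an ordinary polynomial. -/
def firstRelation (f : Polynomial ℚ) : MvPolynomial (Fin 2) ℚ :=
  Polynomial.aeval (MvPolynomial.X 1) f - Polynomial.aeval (MvPolynomial.X 0) f

/-- The second relation, `f(t₃) - f(t₁)`, cleared of denominators by `(t₁ t₂) ^ deg f`. -/
def secondRelation (f : Polynomial ℚ) : MvPolynomial (Fin 2) ℚ :=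
  Polynomial.aeval (MvPolynomial.X 0 * MvPolynomial.X 1) f.reverse -
    (MvPolynomial.X 0 * MvPolynomial.X 1) ^ f.natDegree * Polynomial.aeval (MvPolynomial.X 0) f

lemma homogenizingHom_aeval_X {σ : Type*} (f : Polynomial ℚ) (i : σ) :
    homogenizingHom σ (Polynomial.aeval (MvPolynomial.X i) f) =
      (f.map (algebraMap ℚ (MvPolynomial σ ℚ))).comp
        (Polynomial.C (MvPolynomial.X i) * Polynomial.X) := by
  rw [← Polynomial.aeval_algHom_apply, Polynomial.comp, Polynomial.eval₂_map,
    Polynomial.aeval_def]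
  simp [homogenizingHom]
  rfl

lemma natDegree_homogenizingHom_aeval_X {σ : Type*} (f : Polynomial ℚ) (i : σ) :
    (homogenizingHom σ (Polynomial.aeval (MvPolynomial.X i) f)).natDegree = f.natDegree := by
  rw [homogenizingHom_aeval_X, Polynomial.natDegree_comp,
    Polynomial.natDegree_C_mul_X _ (MvPolynomial.X_ne_zero i), mul_one, Polynomial.natDegree_map]

lemma coeff_homogenizingHom_aeval_X {σ : Type*} (f : Polynomial ℚ) (i : σ) (k : ℕ) :
    (homogenizingHom σ (Polynomial.aeval (MvPolynomial.X i) f)).coeff k =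
      MvPolynomial.C (f.coeff k) * MvPolynomial.X i ^ k := by
  rw [homogenizingHom_aeval_X, Polynomial.comp_C_mul_X_coeff, Polynomial.coeff_map,
    MvPolynomial.algebraMap_eq]

lemma leadingCoeff_homogenizingHom_firstRelation {f : Polynomial ℚ} (hf : 1 ≤ f.natDegree) :
    (homogenizingHom (Fin 2) (firstRelation f)).leadingCoeff =
      MvPolynomial.C f.leadingCoeff *
        (MvPolynomial.X 1 ^ f.natDegree - MvPolynomial.X 0 ^ f.natDegree) := by
  have hf0 : f.leadingCoeff ≠ 0 := by
    rw [Polynomial.leadingCoeff_ne_zero]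
    rintro rfl
    simp at hf
  have hc : (homogenizingHom (Fin 2) (firstRelation f)).coeff f.natDegree =
      MvPolynomial.C f.leadingCoeff *
        (MvPolynomial.X 1 ^ f.natDegree - MvPolynomial.X 0 ^ f.natDegree) := by
    rw [firstRelation, map_sub, Polynomial.coeff_sub, coeff_homogenizingHom_aeval_X,
      coeff_homogenizingHom_aeval_X, Polynomial.coeff_natDegree, mul_sub]
  have hne : (MvPolynomial.X 1 ^ f.natDegree - MvPolynomial.X 0 ^ f.natDegree :
      MvPolynomial (Fin 2) ℚ) ≠ 0 := by
    intro h
    have := congrArg (MvPolynomial.eval (![0, 1] : Fin 2 → ℚ)) h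
    simp [show f.natDegree ≠ 0 by omega] at this
  have hle : (homogenizingHom (Fin 2) (firstRelation f)).natDegree ≤ f.natDegree := by
    rw [firstRelation, map_sub]
    refine (Polynomial.natDegree_sub_le _ _).trans ?_
    simp [natDegree_homogenizingHom_aeval_X]
  have hdeg := Polynomial.natDegree_eq_of_le_of_coeff_ne_zero hle
    (by rw [hc]; exact mul_ne_zero (by simpa using hf0) hne)
  rw [Polynomial.leadingCoeff, hdeg, hc]

lemma leadingCoeff_homogenizingHom_secondRelation {f : Polynomial ℚ} (hf : 1 ≤ f.natDegree) :
    (homogenizingHom (Fin 2) (secondRelation f)).leadingCoeff =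
      MvPolynomial.C (-f.leadingCoeff) *
        ((MvPolynomial.X 0 * MvPolynomial.X 1) ^ f.natDegree *
          MvPolynomial.X 0 ^ f.natDegree) := by
  set u : Polynomial (MvPolynomial (Fin 2) ℚ) :=
    homogenizingHom (Fin 2) (MvPolynomial.X 0 * MvPolynomial.X 1) with hu
  have hu' : u = Polynomial.C (MvPolynomial.X 0 * MvPolynomial.X 1) * Polynomial.X ^ 2 := by
    simp only [hu, homogenizingHom, map_mul, MvPolynomial.aeval_X]
    ring
  have hX : (MvPolynomial.X 0 * MvPolynomial.X 1 : MvPolynomial (Fin 2) ℚ) ≠ 0 :=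
    mul_ne_zero (MvPolynomial.X_ne_zero _) (MvPolynomial.X_ne_zero _)
  have hudeg : u.natDegree = 2 := by
    rw [hu', Polynomial.natDegree_C_mul_X_pow _ _ hX]
  have hu0 : u ≠ 0 := by
    rintro h
    simp [h] at hudeg
  have hulc : u.leadingCoeff = MvPolynomial.X 0 * MvPolynomial.X 1 := by
    rw [hu', Polynomial.leadingCoeff_C_mul_X_pow]
  set v := homogenizingHom (Fin 2) (Polynomial.aeval (MvPolynomial.X 0) f) with hv
  have hvdeg : v.natDegree = f.natDegree := natDegree_homogenizingHom_aeval_X f 0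
  have hv0 : v ≠ 0 := by
    rintro h
    rw [h, Polynomial.natDegree_zero] at hvdeg
    omega
  have hvlc : v.leadingCoeff = MvPolynomial.C f.leadingCoeff * MvPolynomial.X 0 ^ f.natDegree := by
    rw [Polynomial.leadingCoeff, hvdeg, hv, coeff_homogenizingHom_aeval_X,
      Polynomial.coeff_natDegree]
  have hsplit : homogenizingHom (Fin 2) (secondRelation f) =
      Polynomial.aeval u f.reverse - u ^ f.natDegree * v := by
    rw [secondRelation, map_sub, map_mul, map_pow, Polynomial.aeval_algHom_apply]
  have hle : (Polynomial.aeval u f.reverse).natDegree ≤ 2 * f.natDegree := by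
    rw [Polynomial.aeval_eq_sum_range]
    refine Polynomial.natDegree_sum_le_of_forall_le _ _ fun i hi => ?_
    refine (Polynomial.natDegree_smul_le _ _).trans (Polynomial.natDegree_pow_le.trans ?_)
    have := f.reverse_natDegree_le
    rw [Finset.mem_range] at hi
    rw [hudeg]
    omega
  have hlt : (Polynomial.aeval u f.reverse).natDegree < (u ^ f.natDegree * v).natDegree := by
    rw [Polynomial.natDegree_mul (pow_ne_zero _ hu0) hv0, Polynomial.natDegree_pow, hudeg, hvdeg]
    omega
  rw [hsplit, Polynomial.leadingCoeff_sub_of_degree_lt' (Polynomial.degree_lt_degree hlt),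
    Polynomial.leadingCoeff_mul, Polynomial.leadingCoeff_pow, hulc, hvlc, map_neg]
  ring

lemma isRelPrime_firstRelation_secondRelation {f : Polynomial ℚ} (hf : 1 ≤ f.natDegree) :
    IsRelPrime (firstRelation f) (secondRelation f) := by
  have hf0 : f.leadingCoeff ≠ 0 := by
    rw [Polynomial.leadingCoeff_ne_zero]
    rintro rfl
    simp at hf
  have hunit : ∀ {a : ℚ}, a ≠ 0 → IsUnit (MvPolynomial.C a : MvPolynomial (Fin 2) ℚ) :=
    fun ha => (IsUnit.mk0 _ ha).map MvPolynomial.C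
  apply isRelPrime_of_leadingCoeff_homogenizingHom
  rw [leadingCoeff_homogenizingHom_firstRelation hf, leadingCoeff_homogenizingHom_secondRelation hf,
    isRelPrime_mul_unit_left_left (hunit hf0),
    isRelPrime_mul_unit_left_right (hunit (neg_ne_zero.2 hf0))]
  exact MvPolynomial.isRelPrime_X_pow_sub_X_pow (by omega)

/-- The inclusion of ordinary polynomials into Laurent polynomials. -/
def toLaurentTwo : MvPolynomial (Fin 2) ℚ →ₐ[ℚ] LaurentTwo :=
  MvPolynomial.aeval ![t₁, t₂]

lemma toLaurentTwo_X_zero : toLaurentTwo (MvPolynomial.X 0) = t₁ := by simp [toLaurentTwo]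

lemma toLaurentTwo_X_one : toLaurentTwo (MvPolynomial.X 1) = t₂ := by simp [toLaurentTwo]

lemma t₁_mul_t₂_mul_t₃ : t₁ * t₂ * t₃ = 1 := by
  simp [t₁, t₂, t₃, AddMonoidAlgebra.single_mul_single, AddMonoidAlgebra.one_def,
    Prod.zero_eq_mk]

lemma t₁_pow_mul_t₂_pow (a b : ℕ) :
    t₁ ^ a * t₂ ^ b = AddMonoidAlgebra.single ((a : ℤ), (b : ℤ)) (1 : ℚ) := by
  simp [t₁, t₂, AddMonoidAlgebra.single_mul_single, AddMonoidAlgebra.single_pow]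

lemma toLaurentTwo_injective : Function.Injective toLaurentTwo := by
  let e : (Fin 2 →₀ ℕ) →+ ℤ × ℤ :=
    { toFun := fun s => ((s 0 : ℤ), (s 1 : ℤ))
      map_zero' := by simp
      map_add' := by simp }
  have he : Function.Injective e := by
    intro s s' h
    simp only [e, AddMonoidHom.coe_mk, ZeroHom.coe_mk, Prod.mk.injEq, Nat.cast_inj] at h
    ext i
    fin_cases i
    exacts [h.1, h.2]
  have heq : toLaurentTwo = AddMonoidAlgebra.mapDomainAlgHom ℚ ℚ e := by
    apply MvPolynomial.algHom_ext
    intro i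
    rw [toLaurentTwo, MvPolynomial.aeval_X]
    fin_cases i <;>
      simp [MvPolynomial.X, MvPolynomial.monomial, t₁, t₂, e]
  rw [heq]
  exact AddMonoidAlgebra.mapDomain_injective he

lemma exists_toLaurentTwo_eq_pow_mul (p : LaurentTwo) :
    ∃ (N : ℕ) (P : MvPolynomial (Fin 2) ℚ), toLaurentTwo P = (t₁ * t₂) ^ N * p := by
  induction p using AddMonoidAlgebra.induction_linear with
  | zero => exact ⟨0, 0, by simp⟩
  | add p q hp hq =>
    obtain ⟨N, P, hP⟩ := hp
    obtain ⟨N', Q, hQ⟩ := hq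
    refine ⟨N + N', (MvPolynomial.X 0 * MvPolynomial.X 1) ^ N' * P +
      (MvPolynomial.X 0 * MvPolynomial.X 1) ^ N * Q, ?_⟩
    simp only [map_add, map_mul, map_pow, toLaurentTwo_X_zero, toLaurentTwo_X_one, hP, hQ]
    ring
  | single m r =>
    obtain ⟨a, b⟩ := m
    refine ⟨a.natAbs + b.natAbs, MvPolynomial.C r *
      (MvPolynomial.X 0 ^ (a + (a.natAbs + b.natAbs : ℕ)).toNat *
        MvPolynomial.X 1 ^ (b + (a.natAbs + b.natAbs : ℕ)).toNat), ?_⟩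
    rw [mul_pow, t₁_pow_mul_t₂_pow]
    simp only [map_mul, map_pow, toLaurentTwo_X_zero, toLaurentTwo_X_one, t₁_pow_mul_t₂_pow]
    rw [← MvPolynomial.algebraMap_eq, AlgHom.commutes, ← Algebra.smul_def,
      AddMonoidAlgebra.smul_single, AddMonoidAlgebra.single_mul_single]
    congr 1
    · ext <;> simp only [Prod.mk_add_mk] <;> omega
    · simp

lemma toLaurentTwo_firstRelation (f : Polynomial ℚ) :
    toLaurentTwo (firstRelation f) = Polynomial.aeval t₂ f - Polynomial.aeval t₁ f := by
  rw [firstRelation, map_sub, ← Polynomial.aeval_algHom_apply, ← Polynomial.aeval_algHom_apply,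
    toLaurentTwo_X_zero, toLaurentTwo_X_one]

lemma toLaurentTwo_secondRelation (f : Polynomial ℚ) :
    toLaurentTwo (secondRelation f) =
      (t₁ * t₂) ^ f.natDegree * (Polynomial.aeval t₃ f - Polynomial.aeval t₁ f) := by
  let : Invertible t₃ := ⟨t₁ * t₂, t₁_mul_t₂_mul_t₃, by rw [mul_comm, t₁_mul_t₂_mul_t₃]⟩
  have hrev : Polynomial.aeval (t₁ * t₂) f.reverse * t₃ ^ f.natDegree = Polynomial.aeval t₃ f :=
    Polynomial.eval₂_reverse_mul_pow (algebraMap ℚ LaurentTwo) t₃ f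
  have hpow : (t₁ * t₂) ^ f.natDegree * t₃ ^ f.natDegree = 1 := by
    rw [← mul_pow, t₁_mul_t₂_mul_t₃, one_pow]
  rw [secondRelation, map_sub, map_mul, map_pow, ← Polynomial.aeval_algHom_apply,
    ← Polynomial.aeval_algHom_apply, map_mul, toLaurentTwo_X_zero, toLaurentTwo_X_one, ← hrev]
  linear_combination -(Polynomial.aeval (t₁ * t₂) f.reverse) * hpow

/-- Let `f ∈ ℚ[X]` have degree at least 1 and set `t₃ = t₁⁻¹t₂⁻¹` in
`A = ℚ[t₁^{±1}, t₂^{±1}]`.  If `p·(f(t₃) − f(t₁)) = q·(f(t₂) − f(t₁))` in `A`,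
then `f(t₂) − f(t₁)` divides `p` in `A`. -/
theorem divisibility_step (f : Polynomial ℚ) (hf : 1 ≤ f.natDegree) (p q : LaurentTwo)
    (h : p * (Polynomial.aeval t₃ f - Polynomial.aeval t₁ f) =
         q * (Polynomial.aeval t₂ f - Polynomial.aeval t₁ f)) :
    (Polynomial.aeval t₂ f - Polynomial.aeval t₁ f) ∣ p := by
  obtain ⟨N, P, hP⟩ := exists_toLaurentTwo_eq_pow_mul p
  obtain ⟨N', Q, hQ⟩ := exists_toLaurentTwo_eq_pow_mul q
  have hmul : (MvPolynomial.X 0 * MvPolynomial.X 1) ^ N' * P * secondRelation f =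
      firstRelation f *
        ((MvPolynomial.X 0 * MvPolynomial.X 1) ^ (N + f.natDegree) * Q) := by
    apply toLaurentTwo_injective
    simp only [map_mul, map_pow, toLaurentTwo_X_zero, toLaurentTwo_X_one, hP, hQ,
      toLaurentTwo_firstRelation, toLaurentTwo_secondRelation]
    linear_combination (t₁ * t₂) ^ (N + N' + f.natDegree) * h
  obtain ⟨R, hR⟩ := (isRelPrime_firstRelation_secondRelation hf).dvd_of_dvd_mul_right
    (Dvd.intro _ hmul.symm)
  have hdvd : (Polynomial.aeval t₂ f - Polynomial.aeval t₁ f) ∣ (t₁ * t₂) ^ (N' + N) * p := by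
    refine ⟨toLaurentTwo R, ?_⟩
    rw [← toLaurentTwo_firstRelation, ← map_mul, ← hR]
    simp only [map_mul, map_pow, toLaurentTwo_X_zero, toLaurentTwo_X_one, hP]
    ring
  exact ((IsUnit.of_mul_eq_one _ t₁_mul_t₂_mul_t₃).pow _).dvd_mul_left.1 hdvd
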